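/- (Dirac's Gluing Lemma, part (iii).) Let R be a commutative ring and let Δ and Γ be finite abstract simplicial complexes. If Δ, Δ ∪ Γ, and Δ ∩ Γ are all resolution k-chordal over R, then Γ is resolution k-chordal over R. -/

import Mathlib

/-!
Basic notions for homological chordality of simplicial complexes,
following Adiprasito–Nevo–Samper, "Higher chordality: From graphs to complexes".

A finite abstract simplicial complex is modelled as a downward-closed finite
family of finite subsets of a vertex type `V`.  Chains of dimension `k` (with
coefficients in a commutative ring `R`) are functions `Finset V → R` supported
on faces of cardinality `k + 1`; the simplicial boundary operator includes the
augmentation (so `0`-cycles are *reduced* cycles), matching the paper's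
convention that `C₋₁` is generated by the empty face.
-/

open Finset

attribute [local instance] Classical.propDecidable

noncomputable section

/-- A finite abstract simplicial complex with vertices in `V`:
a downward-closed finite family of finite subsets of `V`. -/
structure ASC (V : Type*) where
  faces : Finset (Finset V)
  down_closed : ∀ ⦃s t : Finset V⦄, s ∈ faces → t ⊆ s → t ∈ faces

variable {V : Type*} [Fintype V] [LinearOrder V]

/-- `(-1)` to the number of elements of `t` smaller than `v`; this is the sign
of the position of `v` in the ordered set `insert v t`. -/
def esign (v : V) (t : Finset V) : ℤ :=
  (-1) ^ (t.filter fun w => w < v).card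

/-- The simplicial boundary operator (including the augmentation at the empty
face): `(bdry c) t = ∑_{v ∉ t} ± c (insert v t)`. -/
def bdry {R : Type*} [CommRing R] (c : Finset V → R) : Finset V → R :=
  fun t => ∑ v ∈ tᶜ, esign v t • c (insert v t)

/-- `c` is a chain of dimension `k` on the set of faces `S`:
it is supported on members of `S` of cardinality `k + 1`. -/
def IsChainOn {R : Type*} [CommRing R] (S : Set (Finset V)) (k : ℤ)
    (c : Finset V → R) : Prop :=
  ∀ s : Finset V, c s ≠ 0 → s ∈ S ∧ (s.card : ℤ) = k + 1

/-- The vertex support `c⁰` of a chain: all vertices lying in a face with a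
nonzero coefficient. -/
def vsupp {R : Type*} [CommRing R] (c : Finset V → R) : Set V :=
  {v | ∃ s : Finset V, c s ≠ 0 ∧ v ∈ s}

/-- Vanishing of the `k`-th (reduced) homology of the family of faces `S` over `R`:
every `k`-cycle is the boundary of a `(k+1)`-chain. -/
def HVanish (R : Type*) [CommRing R] (S : Set (Finset V)) (k : ℤ) : Prop :=
  ∀ z : Finset V → R, IsChainOn S k z → bdry z = 0 →
    ∃ c : Finset V → R, IsChainOn S (k + 1) c ∧ bdry c = z

/-- `Δ` is resolution `k`-chordal over `R`: every `k`-cycle `z` of `Δ` admits a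
resolution, i.e. a `(k+1)`-chain `c` of `Δ` with `∂c = z` and the same vertex
support as `z`. -/
def ResChordal (R : Type*) [CommRing R] (Δ : ASC V) (k : ℤ) : Prop :=
  ∀ z : Finset V → R, IsChainOn (↑Δ.faces) k z → bdry z = 0 →
    ∃ c : Finset V → R, IsChainOn (↑Δ.faces) (k + 1) c ∧ bdry c = z ∧ vsupp c = vsupp z

/-- `z` is a complete `k`-cycle on the face set `S`: it is a `k`-cycle whose
faces with nonzero coefficient are precisely all the `k`-dimensional faces of
some set `W` of `k + 2` vertices, and all those faces belong to `S`. -/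
def IsCompleteCycleOn {R : Type*} [CommRing R] (S : Set (Finset V)) (k : ℤ)
    (z : Finset V → R) : Prop :=
  bdry z = 0 ∧ ∃ W : Finset V, (W.card : ℤ) = k + 2 ∧
    (∀ s : Finset V, z s ≠ 0 ↔ s ⊆ W ∧ (s.card : ℤ) = k + 1) ∧
    ∀ s : Finset V, s ⊆ W → (s.card : ℤ) = k + 1 → s ∈ S

/-- `Δ` is decomposition `k`-chordal over `R`: every `k`-cycle `z` of `Δ` is a
sum of complete `k`-cycles of `Δ` supporting only vertices supported in `z`. -/
def DecChordal (R : Type*) [CommRing R] (Δ : ASC V) (k : ℤ) : Prop :=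
  ∀ z : Finset V → R, IsChainOn (↑Δ.faces) k z → bdry z = 0 →
    ∃ (n : ℕ) (zs : Fin n → Finset V → R),
      z = ∑ i, zs i ∧
      ∀ i, IsCompleteCycleOn (↑Δ.faces) k (zs i) ∧ vsupp (zs i) ⊆ vsupp z

/-- `σ` is a missing face (minimal nonface) of `Δ`: `σ` is not a face but all
its proper subsets are.  Its dimension is `σ.card - 1`. -/
def IsMissingFace (Δ : ASC V) (σ : Finset V) : Prop :=
  σ ∉ Δ.faces ∧ ∀ t ⊂ σ, t ∈ Δ.faces

/-- The induced subcomplex `Δ|W` on a subset `W` of the vertices. -/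
def induced (Δ : ASC V) (W : Finset V) : ASC V where
  faces := Δ.faces.filter fun s => s ⊆ W
  down_closed := by
    intro s t hs hts
    simp only [mem_filter] at hs ⊢
    exact ⟨Δ.down_closed hs.1 hts, hts.trans hs.2⟩

/-- `Δ` is `k`-Leray over `R`: the reduced homology `H̃ⱼ(Δ|W; R)` vanishes for
every `j ≥ k` and every vertex subset `W`. -/
def IsLeray (R : Type*) [CommRing R] (Δ : ASC V) (k : ℤ) : Prop :=
  ∀ (W : Finset V) (j : ℤ), k ≤ j → HVanish R (((induced Δ W).faces : Set (Finset V))) j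

/-- The closed star `St_σ Δ = ∪_{σ ⊆ τ ∈ Δ} 2^τ`. -/
def star (Δ : ASC V) (σ : Finset V) : ASC V where
  faces := Δ.faces.filter fun s => ∃ τ ∈ Δ.faces, σ ⊆ τ ∧ s ⊆ τ
  down_closed := by
    intro s t hs hts
    simp only [mem_filter] at hs ⊢
    obtain ⟨h1, τ', h2, h3, h4⟩ := hs
    exact ⟨Δ.down_closed h1 hts, τ', h2, h3, hts.trans h4⟩

/-- The deletion `Δ - σ`: the maximal subcomplex of `Δ` not containing `σ`. -/
def del (Δ : ASC V) (σ : Finset V) : ASC V where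
  faces := Δ.faces.filter fun s => ¬ σ ⊆ s
  down_closed := by
    intro s t hs hts
    simp only [mem_filter] at hs ⊢
    exact ⟨Δ.down_closed hs.1 hts, fun h => hs.2 (h.trans hts)⟩

/-- The extended link `eLk_σ Δ = St_σ Δ - σ`. -/
def eLk (Δ : ASC V) (σ : Finset V) : ASC V := del (star Δ σ) σ

/-- The link `Lk_σ Δ = {τ \ σ : σ ⊆ τ ∈ Δ}`. -/
def link (Δ : ASC V) (σ : Finset V) : ASC V where
  faces := Finset.univ.filter fun t => Disjoint σ t ∧ σ ∪ t ∈ Δ.faces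
  down_closed := by
    intro s t hs hts
    simp only [mem_filter, mem_univ, true_and] at hs ⊢
    exact ⟨hs.1.mono_right hts, Δ.down_closed hs.2 (union_subset_union_right hts)⟩

/-- The `k`-clique complex `Cl_k Δ`: faces are the sets of vertices of `Δ` all
of whose subsets of cardinality at most `k + 1` are faces of `Δ`. -/
def clique (Δ : ASC V) (k : ℤ) : ASC V where
  faces := Finset.univ.filter fun s =>
    (∀ v ∈ s, {v} ∈ Δ.faces) ∧ ∀ t ⊆ s, (t.card : ℤ) ≤ k + 1 → t ∈ Δ.faces
  down_closed := by
    intro s t hs hts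
    simp only [mem_filter, mem_univ, true_and] at hs ⊢
    exact ⟨fun v hv => hs.1 v (hts hv), fun u hu hc => hs.2 u (hu.trans hts) hc⟩

/-- The vertex set of a complex, as a set of elements of `V`. -/
def vertexSet (Δ : ASC V) : Set V := {v | {v} ∈ Δ.faces}

/-- The relative simplicial complex `(Δ, Γ)` is resolution `k`-chordal over `R`:
every relative `k`-cycle (a `k`-chain of `Δ` supported off `Γ` whose boundary
is a chain of `Γ`) admits a resolution, i.e. a `(k+1)`-chain `c` of `Δ`
supported off `Γ` with `∂c ≡ z` modulo chains of `Γ` and `vsupp c = vsupp z`. -/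
def RelResChordal (R : Type*) [CommRing R] (Δ Γ : ASC V) (k : ℤ) : Prop :=
  ∀ z : Finset V → R, IsChainOn (↑Δ.faces) k z → (∀ s, z s ≠ 0 → s ∉ Γ.faces) →
    IsChainOn (↑Γ.faces) (k - 1) (bdry z) →
    ∃ c : Finset V → R, IsChainOn (↑Δ.faces) (k + 1) c ∧ (∀ s, c s ≠ 0 → s ∉ Γ.faces) ∧
      IsChainOn (↑Γ.faces) k (bdry c - z) ∧ vsupp c = vsupp z

/-- The union of two simplicial complexes (taken facewise). -/
def aunion (Δ Γ : ASC V) : ASC V where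
  faces := Δ.faces ∪ Γ.faces
  down_closed := by
    intro s t hs hts
    rcases Finset.mem_union.1 hs with h | h
    · exact Finset.mem_union.2 (Or.inl (Δ.down_closed h hts))
    · exact Finset.mem_union.2 (Or.inr (Γ.down_closed h hts))

/-- The intersection of two simplicial complexes (taken facewise). -/
def ainter (Δ Γ : ASC V) : ASC V where
  faces := Δ.faces ∩ Γ.faces
  down_closed := by
    intro s t hs hts
    rw [Finset.mem_inter] at hs ⊢
    exact ⟨Δ.down_closed hs.1 hts, Γ.down_closed hs.2 hts⟩

/-- The `k`-skeleton of `Δ`: all faces of dimension at most `k`. -/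
def skel (Δ : ASC V) (k : ℤ) : ASC V where
  faces := Δ.faces.filter fun s => (s.card : ℤ) ≤ k + 1
  down_closed := by
    intro s t hs hts
    simp only [mem_filter] at hs ⊢
    refine ⟨Δ.down_closed hs.1 hts, le_trans ?_ hs.2⟩
    exact_mod_cast Finset.card_le_card hts

theorem esign_insert_of_lt {V : Type*} [LinearOrder V] {v w : V} {t : Finset V}
    (hv : v ∉ t) (h : v < w) :
    esign w (insert v t) = -esign w t := by
  unfold esign
  rw [Finset.filter_insert, if_pos h, Finset.card_insert_of_notMem (by simp [hv]), pow_succ]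
  ring

theorem esign_insert_of_gt {V : Type*} [LinearOrder V] {v w : V} {t : Finset V} (h : w < v) :
    esign w (insert v t) = esign w t := by
  unfold esign
  rw [Finset.filter_insert, if_neg h.not_gt]

theorem esign_mul_esign_insert {V : Type*} [LinearOrder V] {v w : V} {t : Finset V}
    (hv : v ∉ t) (hw : w ∉ t) (h : v ≠ w) :
    esign v t * esign w (insert v t) + esign w t * esign v (insert w t) = 0 := by
  rcases lt_or_gt_of_ne h with h | h
  · rw [esign_insert_of_lt hv h, esign_insert_of_gt h]; ring
  · rw [esign_insert_of_lt hw h, esign_insert_of_gt h]; ring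

theorem bdry_bdry {R : Type*} [CommRing R] (c : Finset V → R) : bdry (bdry c) = 0 := by
  funext t
  simp only [bdry, Finset.smul_sum, smul_smul, Pi.zero_apply]
  rw [Finset.sum_sigma']
  refine Finset.sum_involution (fun p _ => ⟨p.2, p.1⟩) ?_ ?_ ?_ ?_
  · rintro ⟨v, w⟩ h
    simp only [mem_sigma, mem_compl, mem_insert, not_or] at h
    simp only [Finset.insert_comm v w t]
    rw [← add_smul, esign_mul_esign_insert h.1 h.2.2 (Ne.symm h.2.1), zero_smul]
  · rintro ⟨v, w⟩ h _ heq
    simp only [mem_sigma, mem_compl, mem_insert, not_or] at h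
    simp only [Sigma.mk.injEq] at heq
    exact h.2.1 heq.1
  · rintro ⟨v, w⟩ h
    simp only [mem_sigma, mem_compl, mem_insert, not_or] at h ⊢
    exact ⟨h.2.2, Ne.symm h.2.1, h.1⟩
  · rintro ⟨v, w⟩ _
    rfl

theorem bdry_add {R : Type*} [CommRing R] (a b : Finset V → R) :
    bdry (a + b) = bdry a + bdry b := by
  funext t
  simp [bdry, smul_add, Finset.sum_add_distrib]

theorem exists_insert_of_bdry_ne_zero {R : Type*} [CommRing R] {c : Finset V → R}
    {t : Finset V} (h : bdry c t ≠ 0) : ∃ v ∉ t, c (insert v t) ≠ 0 := by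
  obtain ⟨v, hv, hne⟩ := Finset.exists_ne_zero_of_sum_ne_zero h
  exact ⟨v, by simpa using hv, fun h0 => hne (by rw [h0, smul_zero])⟩

theorem vsupp_bdry_subset {R : Type*} [CommRing R] (c : Finset V → R) :
    vsupp (bdry c) ⊆ vsupp c := by
  rintro x ⟨t, ht, hx⟩
  obtain ⟨v, -, hv⟩ := exists_insert_of_bdry_ne_zero ht
  exact ⟨_, hv, Finset.mem_insert_of_mem hx⟩

theorem vsupp_add_subset {V : Type*} {R : Type*} [CommRing R] (a b : Finset V → R) :
    vsupp (a + b) ⊆ vsupp a ∪ vsupp b := by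
  rintro x ⟨t, ht, hx⟩
  by_cases ha : a t = 0
  · exact Or.inr ⟨t, fun hb => ht (by simp [ha, hb]), hx⟩
  · exact Or.inl ⟨t, ha, hx⟩

theorem IsChainOn.add {V : Type*} {R : Type*} [CommRing R] {S : Set (Finset V)} {k : ℤ}
    {a b : Finset V → R} (ha : IsChainOn S k a) (hb : IsChainOn S k b) :
    IsChainOn S k (a + b) := by
  intro s hs
  by_cases h : a s = 0
  · exact hb s fun h' => hs (by simp [h, h'])
  · exact ha s h

theorem IsChainOn.sub {V : Type*} {R : Type*} [CommRing R] {S : Set (Finset V)} {k : ℤ}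
    {a b : Finset V → R} (ha : IsChainOn S k a) (hb : IsChainOn S k b) :
    IsChainOn S k (a - b) := by
  intro s hs
  by_cases h : a s = 0
  · exact hb s fun h' => hs (by simp [h, h'])
  · exact ha s h

theorem IsChainOn.bdry {R : Type*} [CommRing R] {Δ : ASC V} {k : ℤ}
    {c : Finset V → R} (hc : IsChainOn (↑Δ.faces) (k + 1) c) :
    IsChainOn (↑Δ.faces) k (bdry c) := by
  intro t ht
  obtain ⟨v, hvt, hv⟩ := exists_insert_of_bdry_ne_zero ht
  obtain ⟨hm, hcard⟩ := hc _ hv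
  refine ⟨Δ.down_closed hm (Finset.subset_insert v t), ?_⟩
  rw [Finset.card_insert_of_notMem hvt] at hcard
  push_cast at hcard
  linarith

/-- **Dirac's Gluing Lemma, part (iii)** (Lemma 4.6(iii)): if `Δ`, `Δ ∪ Γ` and
`Δ ∩ Γ` are resolution `k`-chordal over `R`, then so is `Γ`. -/
theorem dirac_gluing_iii {V : Type*} [Fintype V] [LinearOrder V]
    (R : Type*) [CommRing R] (Δ Γ : ASC V) (k : ℤ)
    (hΔ : ResChordal R Δ k) (hunion : ResChordal R (aunion Δ Γ) k)
    (hinter : ResChordal R (ainter Δ Γ) k) :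
    ResChordal R Γ k := by
  intro z hz hz0
  obtain ⟨c, hc, hcz, hcs⟩ := hunion z
    (fun s hs => ⟨Finset.mem_union_right _ (hz s hs).1, (hz s hs).2⟩) hz0
  set a : Finset V → R := fun s => if s ∈ Γ.faces then 0 else c s with ha
  set b : Finset V → R := fun s => if s ∈ Γ.faces then c s else 0 with hb
  have hab : b + a = c := by
    funext s
    by_cases h : s ∈ Γ.faces <;> simp [ha, hb, h]
  have hac : ∀ s, a s ≠ 0 → s ∉ Γ.faces ∧ c s ≠ 0 := fun s hs => by
    by_cases h : s ∈ Γ.faces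
    · simp [ha, h] at hs
    · exact ⟨h, by simpa [ha, h] using hs⟩
  have hbc : ∀ s, b s ≠ 0 → s ∈ Γ.faces ∧ c s ≠ 0 := fun s hs => by
    by_cases h : s ∈ Γ.faces
    · exact ⟨h, by simpa [hb, h] using hs⟩
    · simp [hb, h] at hs
  have haΔ : IsChainOn (↑Δ.faces) (k + 1) a := fun s hs =>
    ⟨(Finset.mem_union.1 (hc s (hac s hs).2).1).resolve_right (hac s hs).1,
      (hc s (hac s hs).2).2⟩
  have hbΓ : IsChainOn (↑Γ.faces) (k + 1) b := fun s hs =>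
    ⟨(hbc s hs).1, (hc s (hbc s hs).2).2⟩
  have hsum : bdry b + bdry a = z := by rw [← bdry_add, hab, hcz]
  have haΓ : IsChainOn (↑Γ.faces) k (bdry a) := by
    rw [← hsum] at hz
    simpa using hz.sub hbΓ.bdry
  obtain ⟨d, hd, hda, hds⟩ := hinter (bdry a)
    (fun s hs => ⟨Finset.mem_inter.2 ⟨(haΔ.bdry s hs).1, (haΓ s hs).1⟩, (haΓ s hs).2⟩)
    (bdry_bdry a)
  have hbd : bdry (b + d) = z := by rw [bdry_add, hda, hsum]
  refine ⟨b + d, hbΓ.add fun s hs => ⟨(Finset.mem_inter.1 (hd s hs).1).2, (hd s hs).2⟩,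
    hbd, Set.Subset.antisymm ?_ (hbd ▸ vsupp_bdry_subset (b + d))⟩
  refine (vsupp_add_subset b d).trans (Set.union_subset ?_ ?_)
  · rintro x ⟨s, hs, hx⟩
    exact hcs ▸ ⟨s, (hbc s hs).2, hx⟩
  · rw [hds, ← hcs]
    refine (vsupp_bdry_subset a).trans ?_
    rintro x ⟨s, hs, hx⟩
    exact ⟨s, (hac s hs).2, hx⟩
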